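/- The constrained JSR equals the JSR of the Kronecker-lifted system. Let V be a finite type, Σ a finite nonempty alphabet, E : Σ → V → V → Prop a deterministic labeled edge relation, F c the associated transition matrices, A : Σ → Matrix (Fin n) (Fin n) ℝ, and P c := (F c) ⊗ (A c) the lifted matrices. Then: (i) for every ℓ ≥ 1, the maximum of |||P_α||| over all words α : Fin ℓ → Σ equals the maximum of ‖A_α‖ over all feasible words α : Fin ℓ → Σ (with the convention that the maximum over the empty set is 0); and consequently (ii) limsup_{ℓ→∞} max_{α ∈ Σ^ℓ} |||P_α|||^{1/ℓ} = limsup_{ℓ→∞} max_{α ∈ Σ^ℓ feasible} ‖A_α‖^{1/ℓ}, i.e., the joint spectral radius of the lifted arbitrary-switching system (computed with the block norm) equals the constrained joint spectral radius of the original system (computed with the Frobenius norm). -/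

import Mathlib

open Kronecker
open scoped Classical

/-- Frobenius norm of a real `n × n` matrix. -/
noncomputable def frob {n : ℕ} (A : Matrix (Fin n) (Fin n) ℝ) : ℝ :=
  Real.sqrt (∑ i, ∑ j, (A i j) ^ 2)

/-- Transition matrix of label `c`: entry `(i, j)` is `1` if there is an edge
from `j` to `i` labeled `c`, and `0` otherwise. -/
noncomputable def transMat {V Γ : Type*} (E : Γ → V → V → Prop) (c : Γ) :
    Matrix V V ℝ :=
  fun i j => if E c j i then 1 else 0

/-- Ordered product `M (N-1) * ⋯ * M 1 * M 0` of a finite family of elements of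
a monoid. -/
def finWordProd {X : Type*} [Monoid X] {N : ℕ} (M : Fin N → X) : X :=
  ((List.ofFn M).reverse).prod

/-- The word `α` is feasible from node `v`. -/
def FeasibleFrom {V Γ : Type*} (E : Γ → V → V → Prop) {N : ℕ}
    (α : Fin N → Γ) (v : V) : Prop :=
  ∃ w : ℕ → V, w 0 = v ∧ ∀ (t : ℕ) (ht : t < N), E (α ⟨t, ht⟩) (w t) (w (t + 1))

/-- The word `α` is feasible: some node admits a walk labeled `α`. -/
def Feasible {V Γ : Type*} (E : Γ → V → V → Prop) {N : ℕ} (α : Fin N → Γ) : Prop :=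
  ∃ v : V, FeasibleFrom E α v

/-- The `(i, j)` block (an `n × n` matrix) of a block matrix indexed by
`V × Fin n`. -/
def blockOf {V : Type*} {n : ℕ} (M : Matrix (V × Fin n) (V × Fin n) ℝ)
    (i j : V) : Matrix (Fin n) (Fin n) ℝ :=
  fun a b => M (i, a) (j, b)

/-- Block norm `|||M||| = max_{j ∈ V} ∑_{i ∈ V} ‖M[i,j]‖` of a block matrix,
with `‖·‖` the Frobenius norm. -/
noncomputable def blockNorm {V : Type*} [Fintype V] {n : ℕ}
    (M : Matrix (V × Fin n) (V × Fin n) ℝ) : ℝ :=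
  ⨆ j : V, ∑ i : V, frob (blockOf M i j)

theorem finWordProd_zero {X : Type*} [Monoid X] (M : Fin 0 → X) : finWordProd M = 1 := by
  simp [finWordProd]

theorem finWordProd_succ {X : Type*} [Monoid X] {N : ℕ} (M : Fin (N + 1) → X) :
    finWordProd M = finWordProd (fun t : Fin N => M t.succ) * M 0 := by
  simp [finWordProd, List.ofFn_succ]

theorem finWordProd_kronecker {V W : Type*} [Fintype V] [DecidableEq V] [Fintype W]
    [DecidableEq W] {N : ℕ} (F : Fin N → Matrix V V ℝ) (A : Fin N → Matrix W W ℝ) :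
    finWordProd (fun t => F t ⊗ₖ A t) = finWordProd F ⊗ₖ finWordProd A := by
  induction N with
  | zero => simp [finWordProd_zero]
  | succ N ih =>
    rw [finWordProd_succ, finWordProd_succ F, finWordProd_succ A, ih, Matrix.mul_kronecker_mul]

theorem feasibleFrom_succ {V Γ : Type*} {E : Γ → V → V → Prop} {N : ℕ}
    {α : Fin (N + 1) → Γ} {v : V} :
    FeasibleFrom E α v ↔ ∃ u, E (α 0) v u ∧ FeasibleFrom E (fun t : Fin N => α t.succ) u := by
  constructor
  · rintro ⟨w, rfl, hw⟩
    exact ⟨w 1, hw 0 (Nat.succ_pos N), fun t => w (t + 1), rfl,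
      fun t ht => hw (t + 1) (Nat.succ_lt_succ ht)⟩
  · rintro ⟨u, hu, w, rfl, hw⟩
    refine ⟨fun t => Nat.casesOn t v w, rfl, fun t ht => ?_⟩
    cases t with
    | zero => exact hu
    | succ t => exact hw t (Nat.lt_of_succ_lt_succ ht)

/-- In a deterministic graph, every column of the transition matrix of a word has `ℓ¹` norm `1`
or `0`, according to whether the word is feasible from the corresponding node. -/
theorem sum_abs_finWordProd_transMat {V Γ : Type*} [Fintype V] [DecidableEq V]
    {E : Γ → V → V → Prop} (hdet : ∀ (c : Γ) (v w w' : V), E c v w → E c v w' → w = w')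
    {N : ℕ} (α : Fin N → Γ) (v : V) :
    ∑ i, |finWordProd (fun t => transMat E (α t)) i v| = if FeasibleFrom E α v then 1 else 0 := by
  induction N generalizing v with
  | zero =>
    have h : FeasibleFrom E α v := ⟨fun _ => v, rfl, fun t ht => absurd ht (Nat.not_lt_zero t)⟩
    simp [finWordProd_zero, h, Matrix.one_apply, apply_ite abs]
  | succ N ih =>
    simp only [finWordProd_succ, Matrix.mul_apply, feasibleFrom_succ]
    by_cases hu : ∃ u, E (α 0) v u
    · obtain ⟨u, hu⟩ := hu
      have h (k : V) : E (α 0) v k ↔ k = u := ⟨fun hk => hdet _ _ _ _ hk hu, fun hk => hk ▸ hu⟩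
      simp [transMat, h, ← ih]
    · push Not at hu
      simp [transMat, hu]

theorem frob_nonneg {n : ℕ} (A : Matrix (Fin n) (Fin n) ℝ) : 0 ≤ frob A :=
  Real.sqrt_nonneg _

theorem frob_smul {n : ℕ} (c : ℝ) (A : Matrix (Fin n) (Fin n) ℝ) :
    frob (c • A) = |c| * frob A := by
  simp only [frob, Matrix.smul_apply, smul_eq_mul, mul_pow, ← Finset.mul_sum]
  rw [Real.sqrt_mul (sq_nonneg c), Real.sqrt_sq_eq_abs]

theorem blockOf_kronecker {V : Type*} {n : ℕ} (F : Matrix V V ℝ)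
    (A : Matrix (Fin n) (Fin n) ℝ) (i j : V) : blockOf (F ⊗ₖ A) i j = F i j • A := rfl

theorem blockNorm_finWordProd_lift {V Γ : Type*} [Fintype V] [DecidableEq V]
    {E : Γ → V → V → Prop} (hdet : ∀ (c : Γ) (v w w' : V), E c v w → E c v w' → w = w')
    {n : ℕ} (A : Γ → Matrix (Fin n) (Fin n) ℝ) {N : ℕ} (α : Fin N → Γ) :
    blockNorm (finWordProd (fun t => transMat E (α t) ⊗ₖ A (α t))) =
      if Feasible E α then frob (finWordProd (fun t => A (α t))) else 0 := by
  rw [finWordProd_kronecker]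
  simp only [blockNorm, blockOf_kronecker, frob_smul, ← Finset.sum_mul,
    sum_abs_finWordProd_transMat hdet]
  split_ifs with h
  · obtain ⟨v, hv⟩ := h
    have : Nonempty V := ⟨v⟩
    refine le_antisymm (ciSup_le fun j => ?_) ?_
    · split_ifs <;> simp [frob_nonneg]
    · exact le_ciSup_of_le (Set.finite_range _).bddAbove v (by simp [hv])
  · have hv (v : V) : ¬ FeasibleFrom E α v := fun hv => h ⟨v, hv⟩
    simp [hv]

theorem sSup_ite_eq_sSup_of_nonneg {ι : Type*} [Finite ι] [Nonempty ι] (p : ι → Prop)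
    {f : ι → ℝ} (hf : ∀ a, 0 ≤ f a) :
    sSup {r : ℝ | ∃ a, r = if p a then f a else 0} = sSup {r : ℝ | ∃ a, p a ∧ r = f a} := by
  have hp : BddAbove {r : ℝ | ∃ a, p a ∧ r = f a} :=
    (Set.finite_range f).bddAbove.mono (by rintro _ ⟨a, -, rfl⟩; exact ⟨a, rfl⟩)
  have hq : BddAbove {r : ℝ | ∃ a, r = if p a then f a else 0} :=
    (Set.finite_range fun a => if p a then f a else 0).bddAbove.mono
      (by rintro _ ⟨a, rfl⟩; exact ⟨a, rfl⟩)
  apply le_antisymm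
  · refine csSup_le ⟨_, Classical.arbitrary ι, rfl⟩ ?_
    rintro _ ⟨a, rfl⟩
    split_ifs with h
    · exact le_csSup hp ⟨a, h, rfl⟩
    · exact Real.sSup_nonneg (by rintro _ ⟨b, -, rfl⟩; exact hf b)
  · refine Real.sSup_le ?_ (Real.sSup_nonneg ?_)
    · rintro _ ⟨a, h, rfl⟩
      exact le_csSup hq ⟨a, by simp [h]⟩
    · rintro _ ⟨a, rfl⟩
      split_ifs <;> simp [hf]

/-- **The constrained JSR equals the JSR of the Kronecker-lifted system.**
(i) For every `ℓ ≥ 1`, the maximum of `|||P_α|||` over all words of length `ℓ`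
equals the maximum of `‖A_α‖` over all feasible words of length `ℓ` (with
`sSup ∅ = 0` as the convention for a maximum over the empty set); and
(ii) the corresponding `limsup`s of the `ℓ`-th root maxima coincide, i.e. the
JSR of the lifted arbitrary-switching system (block norm) equals the
constrained JSR of the original system (Frobenius norm). -/
theorem cjsr_eq_lifted_jsr {V Γ : Type*}
    [Fintype V] [DecidableEq V] [Fintype Γ] [Nonempty Γ]
    (E : Γ → V → V → Prop)
    (hdet : ∀ (c : Γ) (v w w' : V), E c v w → E c v w' → w = w')
    {n : ℕ} (A : Γ → Matrix (Fin n) (Fin n) ℝ) :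
    (∀ ℓ : ℕ, 1 ≤ ℓ →
      sSup {r : ℝ | ∃ α : Fin ℓ → Γ,
          r = blockNorm (finWordProd (fun t => transMat E (α t) ⊗ₖ A (α t)))} =
        sSup {r : ℝ | ∃ α : Fin ℓ → Γ, Feasible E α ∧
          r = frob (finWordProd (fun t => A (α t)))}) ∧
    (Filter.limsup (fun ℓ : ℕ =>
        sSup {r : ℝ | ∃ α : Fin ℓ → Γ,
          r = blockNorm (finWordProd (fun t => transMat E (α t) ⊗ₖ A (α t)))
              ^ ((1 : ℝ) / (ℓ : ℝ))}) Filter.atTop =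
      Filter.limsup (fun ℓ : ℕ =>
        sSup {r : ℝ | ∃ α : Fin ℓ → Γ, Feasible E α ∧
          r = frob (finWordProd (fun t => A (α t))) ^ ((1 : ℝ) / (ℓ : ℝ))})
        Filter.atTop) := by
  simp only [blockNorm_finWordProd_lift hdet]
  refine ⟨fun ℓ _ => sSup_ite_eq_sSup_of_nonneg _ fun α => frob_nonneg _, ?_⟩
  refine Filter.limsup_congr ?_
  filter_upwards [Filter.eventually_ge_atTop 1] with ℓ hℓ
  have hℓ' : (1 : ℝ) / (ℓ : ℝ) ≠ 0 := one_div_ne_zero (Nat.cast_ne_zero.mpr (by omega))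
  rw [← sSup_ite_eq_sSup_of_nonneg _ fun α => Real.rpow_nonneg (frob_nonneg _) _]
  simp only [apply_ite (fun x : ℝ => x ^ ((1 : ℝ) / (ℓ : ℝ))), Real.zero_rpow hℓ']
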